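/- Let k be algebraically closed and n ≥ 1. There exist no r ≥ 1 and r×r matrices C, D over B, with all entries of C and D in the k-span of {x, y, xy, yx}, satisfying ν(C)D = wI_r and DC = wI_r, such that the image of the left A-linear map Aʳ → Aʳ given by right multiplication by the reduction of C modulo w is isomorphic as a left A-module to C_n(∞). That is, C_n(∞) does not arise from any twisted matrix factorization of w over B. -/

import Mathlib

noncomputable section
open FreeAlgebra Matrix

/-- The defining relations of `B = k⟨x,y⟩/(x², y², xyx, yxy)`. -/
inductive BRel (k : Type*) [Field k] : FreeAlgebra k (Fin 2) → FreeAlgebra k (Fin 2) → Prop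
  | xx : BRel k (ι k 0 * ι k 0) 0
  | yy : BRel k (ι k 1 * ι k 1) 0
  | xyx : BRel k (ι k 0 * ι k 1 * ι k 0) 0
  | yxy : BRel k (ι k 1 * ι k 0 * ι k 1) 0

/-- The algebra `B = k⟨x,y⟩/(x², y², xyx, yxy)`. -/
abbrev B (k : Type*) [Field k] := RingQuot (BRel k)

/-- The image of the generator `x` in `B`. -/
def Bx (k : Type*) [Field k] : B k := RingQuot.mkAlgHom k (BRel k) (ι k 0)

/-- The image of the generator `y` in `B`. -/
def By (k : Type*) [Field k] : B k := RingQuot.mkAlgHom k (BRel k) (ι k 1)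

/-- The element `w = xy - q·yx` of `B`. -/
def wB (k : Type*) [Field k] (q : k) : B k := Bx k * By k - q • (By k * Bx k)
set_option maxSynthPendingDepth 3

/-- The relation generating the two-sided ideal `(w)` of `B`. -/
inductive ARel (k : Type*) [Field k] (q : k) : B k → B k → Prop
  | w : ARel k q (wB k q) 0

/-- The quantum complete intersection `A = B/(w)`. -/
abbrev Aalg (k : Type*) [Field k] (q : k) := RingQuot (ARel k q)

/-- The quotient map `B → A = B/(w)`. -/
def piA (k : Type*) [Field k] (q : k) : B k →ₐ[k] Aalg k q :=
  RingQuot.mkAlgHom k (ARel k q)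

/-- The image of `x` in `A`. -/
def Ax (k : Type*) [Field k] (q : k) : Aalg k q := piA k q (Bx k)

/-- The image of `y` in `A`. -/
def Ay (k : Type*) [Field k] (q : k) : Aalg k q := piA k q (By k)

/-- Regard a matrix over `k` as a matrix over `B` via the structure map. -/
def matB (k : Type*) [Field k] {r : ℕ} (M : Matrix (Fin r) (Fin r) k) :
    Matrix (Fin r) (Fin r) (B k) :=
  M.map (algebraMap k (B k))

/-- The `n × n` Jordan block with eigenvalue `l` (`l` on the diagonal, `1` on the
superdiagonal). -/
def jordan (k : Type*) [Field k] (n : ℕ) (l : k) : Matrix (Fin n) (Fin n) k :=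
  Matrix.of fun i j => if (j : ℕ) = (i : ℕ) then l else if (j : ℕ) = (i : ℕ) + 1 then 1 else 0

/-- The image (as a `k`-subspace of `Aʳ`) of right multiplication of row vectors by a
matrix `M` over `A`. -/
def imageM (k : Type*) [Field k] (q : k) {r : ℕ} (M : Matrix (Fin r) (Fin r) (Aalg k q)) :
    Submodule k (Fin r → Aalg k q) :=
  Submodule.span k (Set.range fun u : Fin r → Aalg k q => u ᵥ* M)

theorem Bx_mul_Bx (k : Type*) [Field k] : Bx k * Bx k = 0 := by
  simpa [Bx] using RingQuot.mkAlgHom_rel k (BRel.xx (k := k))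

theorem By_mul_By (k : Type*) [Field k] : By k * By k = 0 := by
  simpa [By] using RingQuot.mkAlgHom_rel k (BRel.yy (k := k))

theorem Bx_mul_By_mul_Bx (k : Type*) [Field k] : Bx k * (By k * Bx k) = 0 := by
  simpa [Bx, By, mul_assoc] using RingQuot.mkAlgHom_rel k (BRel.xyx (k := k))

theorem By_mul_Bx_mul_By (k : Type*) [Field k] : By k * (Bx k * By k) = 0 := by
  simpa [Bx, By, mul_assoc] using RingQuot.mkAlgHom_rel k (BRel.yxy (k := k))

/-- The algebra map out of `B` determined by images of the generators. -/
def liftB (k : Type*) [Field k] {S : Type*} [Semiring S] [Algebra k S] (X Y : S)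
    (hxx : X * X = 0) (hyy : Y * Y = 0) (hxyx : X * Y * X = 0) (hyxy : Y * X * Y = 0) :
    B k →ₐ[k] S :=
  RingQuot.liftAlgHom k ⟨FreeAlgebra.lift k ![X, Y], by
    intro a b h
    cases h <;> simp [hxx, hyy, hxyx, hyxy]⟩

theorem liftB_Bx (k : Type*) [Field k] {S : Type*} [Semiring S] [Algebra k S] (X Y : S)
    (hxx : X * X = 0) (hyy : Y * Y = 0) (hxyx : X * Y * X = 0) (hyxy : Y * X * Y = 0) :
    liftB k X Y hxx hyy hxyx hyxy (Bx k) = X := by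
  simp [liftB, Bx]

theorem liftB_By (k : Type*) [Field k] {S : Type*} [Semiring S] [Algebra k S] (X Y : S)
    (hxx : X * X = 0) (hyy : Y * Y = 0) (hxyx : X * Y * X = 0) (hyxy : Y * X * Y = 0) :
    liftB k X Y hxx hyy hxyx hyxy (By k) = Y := by
  simp [liftB, By]

/-- Left multiplication on `B` by an arbitrary element, seen from the generators. -/
theorem exists_gen_mul (k : Type*) [Field k] (u : B k) :
    ∃ a b c : k, By k * u = a • By k + b • (By k * Bx k) ∧
      Bx k * u = a • Bx k + c • (Bx k * By k) := by
  obtain ⟨u, rfl⟩ := RingQuot.mkAlgHom_surjective k (BRel k) u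
  induction u using FreeAlgebra.induction with
  | grade0 t =>
    refine ⟨t, 0, 0, ?_, ?_⟩ <;> simp [Algebra.algebraMap_eq_smul_one]
  | grade1 i =>
    fin_cases i
    · exact ⟨0, 1, 0, by simp [Bx], by simpa [Bx] using Bx_mul_Bx k⟩
    · exact ⟨0, 0, 1, by simpa [By] using By_mul_By k, by simp [By]⟩
  | mul u v hu hv =>
    obtain ⟨a, b, c, h₁, h₂⟩ := hu
    obtain ⟨a', b', c', h₃, h₄⟩ := hv
    refine ⟨a * a', a * b' + b * a', a * c' + c * a', ?_, ?_⟩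
    · rw [map_mul, ← mul_assoc, h₁, add_mul, smul_mul_assoc, smul_mul_assoc, mul_assoc, h₃, h₄,
        mul_add, mul_smul_comm, mul_smul_comm, By_mul_Bx_mul_By]
      module
    · rw [map_mul, ← mul_assoc, h₂, add_mul, smul_mul_assoc, smul_mul_assoc, mul_assoc, h₃, h₄,
        mul_add, mul_smul_comm, mul_smul_comm, Bx_mul_By_mul_Bx]
      module
  | add u v hu hv =>
    obtain ⟨a, b, c, h₁, h₂⟩ := hu
    obtain ⟨a', b', c', h₃, h₄⟩ := hv
    refine ⟨a + a', b + b', c + c', ?_, ?_⟩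
    · rw [map_add, mul_add, h₁, h₃]
      module
    · rw [map_add, mul_add, h₂, h₄]
      module

theorem exists_coeffs (k : Type*) [Field k] {c : B k}
    (hc : c ∈ Submodule.span k ({Bx k, By k, Bx k * By k, By k * Bx k} : Set (B k))) :
    ∃ c₁ c₂ c₃ c₄ : k, c = c₁ • Bx k + c₂ • By k + c₃ • (Bx k * By k) + c₄ • (By k * Bx k) := by
  simp only [Submodule.mem_span_insert, Submodule.mem_span_singleton] at hc
  obtain ⟨c₁, _, ⟨c₂, _, ⟨c₃, _, ⟨c₄, rfl⟩, rfl⟩, rfl⟩, rfl⟩ := hc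
  exact ⟨c₁, c₂, c₃, c₄, by module⟩

theorem piA_By_mul_Bx_ne_zero (k : Type*) [Field k] (q : k) : piA k q (By k * Bx k) ≠ 0 := by
  let X : Matrix (Fin 4) (Fin 4) k := !![0, 0, 0, 0; 1, 0, 0, 0; 0, 0, 0, 0; 0, 0, q, 0]
  let Y : Matrix (Fin 4) (Fin 4) k := !![0, 0, 0, 0; 0, 0, 0, 0; 1, 0, 0, 0; 0, 1, 0, 0]
  let f : B k →ₐ[k] Matrix (Fin 4) (Fin 4) k := liftB k X Y
    (by ext i j; fin_cases i <;> fin_cases j <;> simp [X, Matrix.mul_apply, Fin.sum_univ_four])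
    (by ext i j; fin_cases i <;> fin_cases j <;> simp [Y, Matrix.mul_apply, Fin.sum_univ_four])
    (by ext i j; fin_cases i <;> fin_cases j <;> simp [X, Y, Matrix.mul_apply, Fin.sum_univ_four])
    (by ext i j; fin_cases i <;> fin_cases j <;> simp [X, Y, Matrix.mul_apply, Fin.sum_univ_four])
  have hfx : f (Bx k) = X := liftB_Bx ..
  have hfy : f (By k) = Y := liftB_By ..
  let g : Aalg k q →ₐ[k] Matrix (Fin 4) (Fin 4) k := RingQuot.liftAlgHom k ⟨f, by
    intro a b h
    cases h
    simp only [wB, map_sub, map_mul, map_smul, map_zero, hfx, hfy]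
    ext i j
    fin_cases i <;> fin_cases j <;> simp [X, Y]⟩
  intro h
  have h₁ : g (piA k q (By k * Bx k)) = f (By k * Bx k) := by
    simp only [g, piA, RingQuot.liftAlgHom_mkAlgHom_apply]
  rw [h, map_zero, map_mul, hfx, hfy] at h₁
  simpa [X, Y, Matrix.mul_apply, Fin.sum_univ_four] using congrFun (congrFun h₁ 3) 0

/-- An algebra map out of `B` one of whose entries reads off the coefficient of `yx`. -/
theorem exists_rep (k : Type*) [Field k] : ∃ f : B k →ₐ[k] Matrix (Fin 3) (Fin 3) k,
    f (Bx k) = !![0, 0, 0; 0, 0, 1; 0, 0, 0] ∧ f (By k) = !![0, 1, 0; 0, 0, 0; 0, 0, 0] := by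
  refine ⟨liftB k !![0, 0, 0; 0, 0, 1; 0, 0, 0] !![0, 1, 0; 0, 0, 0; 0, 0, 0] ?_ ?_ ?_ ?_,
    liftB_Bx .., liftB_By ..⟩ <;>
  · ext i j
    fin_cases i <;> fin_cases j <;> simp [Matrix.mul_apply, Fin.sum_univ_three]

theorem mem_imageM {k : Type*} [Field k] {q : k} {r : ℕ}
    {M : Matrix (Fin r) (Fin r) (Aalg k q)} {m : Fin r → Aalg k q} (hm : m ∈ imageM k q M) :
    ∃ u, m = u ᵥ* M := by
  induction hm using Submodule.span_induction with
  | mem _ h => obtain ⟨u, rfl⟩ := h; exact ⟨u, rfl⟩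
  | zero => exact ⟨0, by simp⟩
  | add _ _ _ _ h₁ h₂ =>
    obtain ⟨u, rfl⟩ := h₁
    obtain ⟨v, rfl⟩ := h₂
    exact ⟨u + v, (Matrix.add_vecMul ..).symm⟩
  | smul t _ _ h =>
    obtain ⟨u, rfl⟩ := h
    exact ⟨t • u, (Matrix.smul_vecMul ..).symm⟩

/-- If `C` is a factor of `w`, then on the image of `C` the kernel of `y` is contained in that
of `x`. -/
theorem Ax_smul_eq_zero {k : Type*} [Field k] {q : k} (hq : q ≠ 0) {r : ℕ}
    {C D : Matrix (Fin r) (Fin r) (B k)}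
    (hC : ∀ i j, C i j ∈
      Submodule.span k ({Bx k, By k, Bx k * By k, By k * Bx k} : Set (B k)))
    (hD : ∀ i j, D i j ∈
      Submodule.span k ({Bx k, By k, Bx k * By k, By k * Bx k} : Set (B k)))
    (hDC : D * C = wB k q • (1 : Matrix (Fin r) (Fin r) (B k)))
    {m : Fin r → Aalg k q} (hm : m ∈ imageM k q (C.map ⇑(piA k q))) (hy : Ay k q • m = 0) :
    Ax k q • m = 0 := by
  choose c₁ c₂ c₃ c₄ hc using fun i j => exists_coeffs k (hC i j)
  choose d₁ d₂ d₃ d₄ hd using fun i j => exists_coeffs k (hD i j)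
  have hdc : (Matrix.of d₂ : Matrix (Fin r) (Fin r) k) * Matrix.of c₁ = (-q) • 1 := by
    obtain ⟨f, hfx, hfy⟩ := exists_rep k
    ext i j
    have h := congrArg (fun b => f b 0 2) (congrFun (congrFun hDC i) j)
    simp only [Matrix.mul_apply, map_sum, Matrix.sum_apply, map_mul, hc, hd, map_add, map_smul,
      hfx, hfy, Matrix.smul_apply, smul_eq_mul, wB, map_sub] at h
    by_cases hij : i = j
    · subst hij
      simpa [Matrix.mul_apply, Fin.sum_univ_three] using h
    · simpa [Matrix.mul_apply, Fin.sum_univ_three, hij] using h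
  obtain ⟨u, rfl⟩ := mem_imageM hm
  choose U hU using fun i => RingQuot.mkAlgHom_surjective k (ARel k q) (u i)
  choose a b c hyU hxU using fun i => exists_gen_mul k (U i)
  have key (z : B k) (j : Fin r) : (piA k q z • (u ᵥ* C.map ⇑(piA k q))) j =
      piA k q (∑ i, z * U i * C i j) := by
    simp only [Pi.smul_apply, smul_eq_mul, Matrix.vecMul, dotProduct, Matrix.map_apply, map_sum,
      map_mul, Finset.mul_sum, mul_assoc]
    refine Finset.sum_congr rfl fun i _ => ?_
    rw [← hU i]
    rfl
  have hyC (i j : Fin r) : By k * U i * C i j = (a i * c₁ i j) • (By k * Bx k) := by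
    rw [hyU, hc]
    simp only [add_mul, mul_add, smul_mul_assoc, mul_smul_comm, mul_assoc, By_mul_By, Bx_mul_Bx,
      Bx_mul_By_mul_Bx, By_mul_Bx_mul_By, ← mul_assoc (By k) (By k), ← mul_assoc (Bx k) (Bx k),
      zero_mul, mul_zero, smul_zero, add_zero, smul_smul, mul_comm (a i)]
  have hxC (i j : Fin r) : Bx k * U i * C i j = (a i * c₂ i j) • (Bx k * By k) := by
    rw [hxU, hc]
    simp only [add_mul, mul_add, smul_mul_assoc, mul_smul_comm, mul_assoc, By_mul_By, Bx_mul_Bx,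
      Bx_mul_By_mul_Bx, By_mul_Bx_mul_By, ← mul_assoc (By k) (By k), ← mul_assoc (Bx k) (Bx k),
      zero_mul, mul_zero, smul_zero, add_zero, zero_add, smul_smul, mul_comm (a i)]
  have hac : a ᵥ* Matrix.of c₁ = 0 := by
    ext j
    have h := congrFun hy j
    rw [Ay, key] at h
    simp only [hyC, ← Finset.sum_smul, map_smul] at h
    exact (smul_eq_zero.mp h).resolve_right (piA_By_mul_Bx_ne_zero k q)
  have ha : a = 0 := by
    have h₁ : ((-q)⁻¹ • Matrix.of d₂ : Matrix (Fin r) (Fin r) k) * Matrix.of c₁ = 1 := by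
      rw [Matrix.smul_mul, hdc, smul_smul, inv_mul_cancel₀ (neg_ne_zero.mpr hq), one_smul]
    rw [← Matrix.vecMul_one a, ← mul_eq_one_comm.mp h₁, ← Matrix.vecMul_vecMul, hac,
      Matrix.zero_vecMul]
  ext j
  rw [Ax, key]
  simp [hxC, ha]

theorem stmt17 (k : Type*) [Field k] [IsAlgClosed k] (q : k) (hq : q ≠ 0)
    (ν : B k ≃ₐ[k] B k)
    (hνx : ν (Bx k) = -(q⁻¹ • Bx k)) (hνy : ν (By k) = -(q • By k))
    (n : ℕ) (hn : 1 ≤ n) :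
    ¬ ∃ (r : ℕ) (_ : 1 ≤ r) (C D : Matrix (Fin r) (Fin r) (B k)),
      (∀ i j, C i j ∈
        Submodule.span k ({Bx k, By k, Bx k * By k, By k * Bx k} : Set (B k))) ∧
      (∀ i j, D i j ∈
        Submodule.span k ({Bx k, By k, Bx k * By k, By k * Bx k} : Set (B k))) ∧
      C.map ⇑ν * D = wB k q • (1 : Matrix (Fin r) (Fin r) (B k)) ∧
      D * C = wB k q • (1 : Matrix (Fin r) (Fin r) (B k)) ∧
      ∃ e : (Fin n ⊕ Fin n → k) ≃ₗ[k] imageM k q (C.map ⇑(piA k q)),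
        (∀ v : Fin n ⊕ Fin n → k,
          (e (Matrix.fromBlocks 0 1 0 0 *ᵥ v) : Fin r → Aalg k q) =
            Ax k q • (e v : Fin r → Aalg k q)) ∧
        (∀ v : Fin n ⊕ Fin n → k,
          (e (Matrix.fromBlocks 0 (jordan k n 0) 0 0 *ᵥ v) : Fin r → Aalg k q) =
            Ay k q • (e v : Fin r → Aalg k q)) := by
  rintro ⟨r, -, C, D, hC, hD, -, hDC, e, hex, hey⟩
  let i₀ : Fin n := ⟨0, hn⟩
  let v : Fin n ⊕ Fin n → k := Sum.elim 0 (Pi.single i₀ 1)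
  have hJ : Matrix.fromBlocks 0 (jordan k n 0) 0 0 *ᵥ v = (0 : Fin n ⊕ Fin n → k) := by
    have hv : v ∘ Sum.inr = Pi.single i₀ 1 := rfl
    rw [Matrix.fromBlocks_mulVec, hv]
    ext i
    cases i <;> simp [jordan, i₀]
  have hy := hey v
  rw [hJ, map_zero, ZeroMemClass.coe_zero] at hy
  have hx := hex v
  rw [Ax_smul_eq_zero hq hC hD hDC (e v).2 hy.symm, ZeroMemClass.coe_eq_zero,
    LinearEquiv.map_eq_zero_iff, Matrix.fromBlocks_mulVec] at hx
  simpa [v] using congrFun hx (Sum.inl i₀)
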